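/- The barycenter of the vertices of the Stasheff polytope is the point ((n+1)/2, …, (n+1)/2): that is, Σ_{t ∈ Y_n} M(t) = C_n · ((n+1)/2, …, (n+1)/2) in ℝ^n, where C_n = |Y_n| is the n-th Catalan number. In particular the Stasheff polytope and the permutohedron (whose vertex barycenter (1/n!) Σ_{σ ∈ S_n} M(σ) also equals ((n+1)/2, …, (n+1)/2)) have the same barycenter. -/

import Mathlib

/-- Planar binary trees: a tree is either a single leaf, or the grafting
`node l r = l ∨ r` of two planar binary trees. `Y n` is the set of such trees with
`n + 1` leaves. -/
inductive PBT : Type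
  | leaf : PBT
  | node : PBT → PBT → PBT
  deriving DecidableEq

namespace PBT

/-- Number of leaves of a planar binary tree. A tree of `Y n` has `n + 1` leaves. -/
def leaves : PBT → ℕ
  | leaf => 1
  | node l r => l.leaves + r.leaves

/-- The list of coordinates of Loday's point `M(t)`: `M(|)` is the empty tuple and
`M(t^l ∨ t^r) = (M(t^l), p·q, M(t^r))` where `p`, `q` are the numbers of leaves of
`t^l`, `t^r`.  The `i`-th entry is the weight `a_i · b_i` of the `i`-th internal
vertex of `t`.  A tree `t` belongs to `Y n` iff `t.coords.length = n`. -/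
noncomputable def coords : PBT → List ℝ
  | leaf => []
  | node l r => l.coords ++ ((l.leaves : ℝ) * (r.leaves : ℝ)) :: r.coords

/-- The point `M(t) = (a_1 b_1, …, a_n b_n) ∈ ℝ^n`, for `t ∈ Y n`
(coordinates indexed by `Fin n`, the `i`-th coordinate being `x_{i+1}`). -/
noncomputable def M (n : ℕ) (t : PBT) : Fin n → ℝ := fun i => t.coords.getD i 0

end PBT

/-- The permutohedron vertex `M(σ) = (σ(1), …, σ(n))`
(0-indexed: the `i`-th coordinate is `σ(i) + 1`). -/
noncomputable def Mperm (n : ℕ) (σ : Equiv.Perm (Fin n)) : Fin n → ℝ :=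
  fun i => ((σ i : ℕ) : ℝ) + 1

namespace PBT

open Finset

theorem leaves_eq_length_coords_add_one (t : PBT) : t.leaves = t.coords.length + 1 := by
  induction t with
  | leaf => rfl
  | node l r hl hr =>
    simp only [leaves, coords, hl, hr, List.length_append, List.length_cons]
    omega

/-- The finset of planar binary trees with `n` internal vertices. -/
def treesWithVertices : ℕ → Finset PBT
  | 0 => {leaf}
  | n + 1 => (antidiagonal n).attach.biUnion fun ab =>
      (treesWithVertices ab.1.1 ×ˢ treesWithVertices ab.1.2).image fun lr => node lr.1 lr.2
  decreasing_by
    · have := HasAntidiagonal.mem_antidiagonal.1 ab.2; omega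
    · have := HasAntidiagonal.mem_antidiagonal.1 ab.2; omega

theorem treesWithVertices_zero : treesWithVertices 0 = {leaf} := by
  rw [treesWithVertices]

theorem treesWithVertices_succ (n : ℕ) :
    treesWithVertices (n + 1) = (antidiagonal n).biUnion fun ab =>
      (treesWithVertices ab.1 ×ˢ treesWithVertices ab.2).image fun lr => node lr.1 lr.2 := by
  rw [treesWithVertices]
  ext
  simp

theorem mem_treesWithVertices {t : PBT} {n : ℕ} :
    t ∈ treesWithVertices n ↔ t.coords.length = n := by
  induction t generalizing n with
  | leaf => cases n <;> simp [treesWithVertices_zero, treesWithVertices_succ, coords]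
  | node l r hl hr =>
    cases n with
    | zero => simp [treesWithVertices_zero, coords]
    | succ n =>
      simp only [treesWithVertices_succ, mem_biUnion, HasAntidiagonal.mem_antidiagonal,
        mem_image, mem_product, Prod.exists, node.injEq, coords, List.length_append, List.length_cons]
      constructor
      · rintro ⟨a, b, hab, l', r', ⟨h₁, h₂⟩, rfl, rfl⟩
        have := hl.1 h₁
        have := hr.1 h₂
        omega
      · intro h
        exact ⟨l.coords.length, r.coords.length, by omega, l, r, ⟨hl.2 rfl, hr.2 rfl⟩, rfl, rfl⟩

theorem coe_treesWithVertices (n : ℕ) :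
    (treesWithVertices n : Set PBT) = {t : PBT | t.coords.length = n} :=
  Set.ext fun _ => mem_treesWithVertices

theorem sum_treesWithVertices_succ {A : Type*} [AddCommMonoid A] (f : PBT → A) (n : ℕ) :
    ∑ t ∈ treesWithVertices (n + 1), f t = ∑ ab ∈ antidiagonal n,
      ∑ l ∈ treesWithVertices ab.1, ∑ r ∈ treesWithVertices ab.2, f (node l r) := by
  rw [treesWithVertices_succ, sum_biUnion]
  · refine sum_congr rfl fun ab _ => ?_
    rw [sum_image, sum_product]
    rintro ⟨l, r⟩ _ ⟨l', r'⟩ _ h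
    simpa using h
  · rintro ⟨a, b⟩ _ ⟨a', b'⟩ _ hne
    rw [Function.onFun, disjoint_left]
    intro t ht ht'
    simp only [mem_image, mem_product, Prod.exists, mem_treesWithVertices] at ht ht'
    obtain ⟨l, r, ⟨rfl, rfl⟩, rfl⟩ := ht
    obtain ⟨l', r', ⟨rfl, rfl⟩, h⟩ := ht'
    obtain ⟨rfl, rfl⟩ := node.inj h
    exact hne rfl

theorem card_treesWithVertices (n : ℕ) : #(treesWithVertices n) = catalan n := by
  induction n using Nat.strong_induction_on with
  | _ n ih =>
    cases n with
    | zero => simp [treesWithVertices_zero]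
    | succ n =>
      rw [card_eq_sum_ones, sum_treesWithVertices_succ, catalan_succ']
      refine sum_congr rfl fun ab hab => ?_
      rw [HasAntidiagonal.mem_antidiagonal] at hab
      simp [ih ab.1 (by omega), ih ab.2 (by omega)]

/-- The contribution to the `i`-th coordinate of the sum of the `M(t)` of the trees `t` with `a`
vertices left and `b` vertices right of the root, once the barycenters in dimensions `a` and `b`
are known. -/
noncomputable def graftWeight (i a b : ℕ) : ℝ :=
  if i < a then (a + 1) * catalan a * catalan b / 2
  else if i = a then (a + 1) * catalan a * ((b + 1) * catalan b)
  else catalan a * ((b + 1) * catalan b) / 2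

theorem add_two_mul_catalan_succ (n : ℕ) :
    ((n : ℝ) + 2) * catalan (n + 1) = 2 * (2 * n + 1) * catalan n := by
  have h := Nat.succ_mul_centralBinom_succ n
  rw [← succ_mul_catalan_eq_centralBinom, ← succ_mul_catalan_eq_centralBinom] at h
  have h' : ((n : ℝ) + 1) * (((n : ℝ) + 1 + 1) * catalan (n + 1)) =
      2 * (2 * n + 1) * ((n + 1) * catalan n) := by exact_mod_cast h
  have hn : (n : ℝ) + 1 ≠ 0 := by positivity
  apply mul_left_cancel₀ hn
  linear_combination h'

theorem sum_antidiagonal_add_one_mul_catalan (n : ℕ) :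
    ∑ ab ∈ antidiagonal n, ((ab.1 : ℝ) + 1) * catalan ab.1 * catalan ab.2 =
      (n + 2) / 2 * catalan (n + 1) := by
  have hswap : ∑ ab ∈ antidiagonal n, ((ab.1 : ℝ) + 1) * catalan ab.1 * catalan ab.2 =
      ∑ ab ∈ antidiagonal n, ((ab.2 : ℝ) + 1) * catalan ab.2 * catalan ab.1 :=
    (Finset.Nat.sum_antidiagonal_swap (n := n)
      (f := fun ab : ℕ × ℕ => ((ab.1 : ℝ) + 1) * catalan ab.1 * catalan ab.2)).symm
  have hadd : ∑ ab ∈ antidiagonal n, ((ab.1 : ℝ) + 1) * catalan ab.1 * catalan ab.2 +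
      ∑ ab ∈ antidiagonal n, ((ab.2 : ℝ) + 1) * catalan ab.2 * catalan ab.1 =
      (n + 2) * catalan (n + 1) := by
    rw [← sum_add_distrib, catalan_succ', Nat.cast_sum, mul_sum]
    refine sum_congr rfl fun ab hab => ?_
    rw [← HasAntidiagonal.mem_antidiagonal.1 hab]
    push_cast
    ring
  linarith

theorem sum_graftWeight {i n : ℕ} (hi : i ≤ n) :
    ∑ ab ∈ antidiagonal n, graftWeight i ab.1 ab.2 = (n + 2) / 2 * catalan (n + 1) := by
  induction i with
  | zero =>
    have h : ∀ ab ∈ antidiagonal n, graftWeight 0 ab.1 ab.2 =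
        ((ab.1 : ℝ) + 1) * catalan ab.1 * catalan ab.2 / 2 +
          if ab = (0, n) then (n + 1 / 2) * (catalan n : ℝ) else 0 := by
      rintro ⟨a, b⟩ hab
      rw [HasAntidiagonal.mem_antidiagonal] at hab
      rcases Nat.eq_zero_or_pos a with rfl | ha
      · obtain rfl : b = n := by simpa using hab
        simp [graftWeight]
        ring
      · simp [graftWeight, ha, ha.ne']
    rw [sum_congr rfl h, sum_add_distrib, ← sum_div, sum_antidiagonal_add_one_mul_catalan,
      sum_ite_eq' _ _ (fun _ => (n + 1 / 2) * (catalan n : ℝ)), if_pos (by simp)]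
    linear_combination -(1 / 4 : ℝ) * add_two_mul_catalan_succ n
  | succ i ih =>
    rw [← ih (by omega), ← sub_eq_zero, ← sum_sub_distrib]
    obtain ⟨j, rfl⟩ : ∃ j, n = i + j + 1 := ⟨n - i - 1, by omega⟩
    set c : ℝ := (2 * i + 1) * catalan i * ((2 * j + 1) * catalan j) with hc
    have h : ∀ ab ∈ antidiagonal (i + j + 1),
        graftWeight (i + 1) ab.1 ab.2 - graftWeight i ab.1 ab.2 =
          (if ab = (i + 1, j) then c else 0) - if ab = (i, j + 1) then c else 0 := by
      rintro ⟨a, b⟩ hab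
      rw [HasAntidiagonal.mem_antidiagonal] at hab
      have hci := add_two_mul_catalan_succ i
      have hcj := add_two_mul_catalan_succ j
      by_cases h₁ : a = i
      · obtain rfl : b = j + 1 := by simp only at hab; omega
        subst h₁
        simp [graftWeight]
        linear_combination (catalan a * (1 / 2 - (a + 1)) : ℝ) * hcj
      by_cases h₂ : a = i + 1
      · obtain rfl : b = j := by simp only at hab; omega
        subst h₂
        simp [graftWeight]
        linear_combination (catalan b * ((b + 1) - 1 / 2) : ℝ) * hci
      have h₃ : i + 1 < a ↔ i < a := by omega
      simp [graftWeight, h₁, h₂, h₃, Ne.symm h₁, Ne.symm h₂]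
    rw [sum_congr rfl h, sum_sub_distrib, sum_ite_eq' _ _ (fun _ => c),
      sum_ite_eq' _ _ (fun _ => c), if_pos (by simp; omega), if_pos (by simp; omega), sub_self]

theorem sum_getD_coords {i n : ℕ} (hi : i < n) :
    ∑ t ∈ treesWithVertices n, t.coords.getD i 0 = catalan n * ((n + 1) / 2 : ℝ) := by
  induction n using Nat.strong_induction_on generalizing i with
  | _ n ih =>
    obtain _ | n := n
    · omega
    rw [sum_treesWithVertices_succ]
    have hroot : ∀ ab ∈ antidiagonal n, ∑ l ∈ treesWithVertices ab.1,
        ∑ r ∈ treesWithVertices ab.2, (node l r).coords.getD i 0 =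
          graftWeight i ab.1 ab.2 := by
      rintro ⟨a, b⟩ hab
      rw [HasAntidiagonal.mem_antidiagonal] at hab
      simp only at hab ⊢
      rcases lt_trichotomy i a with h | h | h
      · calc
          _ = ∑ l ∈ treesWithVertices a, ∑ r ∈ treesWithVertices b, l.coords.getD i 0 := by
            refine sum_congr rfl fun l hl => sum_congr rfl fun r _ => ?_
            rw [mem_treesWithVertices] at hl
            rw [coords, List.getD_append _ _ _ _ (by omega)]
          _ = _ := by
            simp only [sum_const, card_treesWithVertices, nsmul_eq_mul, ← mul_sum]
            rw [ih a (by omega) h, graftWeight, if_pos h]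
            ring
      · calc
          _ = ∑ l ∈ treesWithVertices a, ∑ r ∈ treesWithVertices b,
              ((a : ℝ) + 1) * (b + 1) := by
            refine sum_congr rfl fun l hl => sum_congr rfl fun r hr => ?_
            rw [mem_treesWithVertices] at hl hr
            rw [coords, List.getD_append_right _ _ _ _ (by omega)]
            simp [leaves_eq_length_coords_add_one, hl, hr, h]
          _ = _ := by
            simp only [sum_const, card_treesWithVertices, nsmul_eq_mul]
            rw [graftWeight, if_neg h.not_lt, if_pos h]
            ring
      · calc
          _ = ∑ l ∈ treesWithVertices a, ∑ r ∈ treesWithVertices b,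
              r.coords.getD (i - a - 1) 0 := by
            refine sum_congr rfl fun l hl => sum_congr rfl fun r _ => ?_
            rw [mem_treesWithVertices] at hl
            obtain ⟨k, rfl⟩ : ∃ k, i = a + (k + 1) := ⟨i - a - 1, by omega⟩
            rw [coords, List.getD_append_right _ _ _ _ (by omega), hl, Nat.add_sub_cancel_left,
              List.getD_cons_succ, Nat.add_sub_cancel]
          _ = _ := by
            simp only [sum_const, card_treesWithVertices, nsmul_eq_mul]
            rw [ih b (by omega) (by omega), graftWeight, if_neg h.not_gt, if_neg h.ne']
            ring
    rw [sum_congr rfl hroot, sum_graftWeight (by omega)]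
    push_cast
    ring

end PBT

theorem sum_Mperm_apply (n : ℕ) (i : Fin n) :
    ∑ σ : Equiv.Perm (Fin n), Mperm n σ i = n.factorial * (((n : ℝ) + 1) / 2) := by
  have hrev : ∑ σ : Equiv.Perm (Fin n), Mperm n σ i =
      ∑ σ : Equiv.Perm (Fin n), Mperm n (Fin.revPerm * σ) i :=
    (Equiv.sum_comp (Equiv.mulLeft Fin.revPerm) fun σ => Mperm n σ i).symm
  have hadd : ∑ σ : Equiv.Perm (Fin n), Mperm n σ i +
      ∑ σ : Equiv.Perm (Fin n), Mperm n (Fin.revPerm * σ) i = n.factorial * ((n : ℝ) + 1) := by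
    have h (σ : Equiv.Perm (Fin n)) :
        Mperm n σ i + Mperm n (Fin.revPerm * σ) i = (n : ℝ) + 1 := by
      simp only [Mperm, Equiv.Perm.mul_apply, Fin.revPerm_apply, Fin.val_rev]
      rw [Nat.cast_sub (σ i).isLt]
      push_cast
      ring
    rw [← Finset.sum_add_distrib, Finset.sum_congr rfl fun σ _ => h σ]
    rw [Finset.sum_const, Finset.card_univ, Fintype.card_perm, Fintype.card_fin, nsmul_eq_mul]
  linarith

/-- The barycenter of the vertices of the Stasheff polytope is `((n+1)/2, …, (n+1)/2)`:
`Σ_{t ∈ Y n} M(t) = C_n • ((n+1)/2, …, (n+1)/2)` where `C_n = |Y n|` is the `n`-th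
Catalan number.  In particular the Stasheff polytope and the permutohedron, whose
vertex barycenter `(1/n!) Σ_{σ ∈ S_n} M(σ)` also equals `((n+1)/2, …, (n+1)/2)`,
have the same barycenter. -/
theorem stmt10 (n : ℕ) :
    Set.ncard {t : PBT | t.coords.length = n} = catalan n ∧
    (∑ᶠ t ∈ {t : PBT | t.coords.length = n}, PBT.M n t)
      = (catalan n : ℝ) • (fun _ : Fin n => ((n : ℝ) + 1) / 2) ∧
    (∑ σ : Equiv.Perm (Fin n), Mperm n σ)
      = (n.factorial : ℝ) • (fun _ : Fin n => ((n : ℝ) + 1) / 2) := by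
  rw [← PBT.coe_treesWithVertices]
  refine ⟨by rw [Set.ncard_coe_finset, PBT.card_treesWithVertices], ?_, ?_⟩
  · rw [finsum_mem_coe_finset]
    funext i
    simpa [PBT.M] using PBT.sum_getD_coords i.isLt
  · funext i
    simpa using sum_Mperm_apply n i
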